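/- Let f : ℝ^n → ℝ be locally Lipschitz and upper-C¹ at a point x̄ ∈ ℝ^n. Then the standard model of f is strict at x̄; that is, for every ε > 0 there exists r > 0 such that f(η) ≤ f(δ) + f°(δ; η − δ) + ε‖η − δ‖ for all δ, η in the open ball B(x̄, r). -/

import Mathlib

open scoped RealInnerProductSpace

noncomputable section

/-- A witness that `f` is lower-C¹ at `x₀`: a compact topological space `K`, an open
neighborhood `U` of `x₀`, and a jointly continuous `F : U × K → ℝ` whose partial
differential in the first variable exists and is jointly continuous on `U × K`, with
`f x = max_{y ∈ K} F (x, y)` for all `x ∈ U`. -/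
structure LowerC1Witness (n : ℕ) (f : EuclideanSpace ℝ (Fin n) → ℝ)
    (x₀ : EuclideanSpace ℝ (Fin n)) where
  K : Type
  [tK : TopologicalSpace K]
  [cK : CompactSpace K]
  [nK : Nonempty K]
  U : Set (EuclideanSpace ℝ (Fin n))
  openU : IsOpen U
  memU : x₀ ∈ U
  F : EuclideanSpace ℝ (Fin n) → K → ℝ
  DF : EuclideanSpace ℝ (Fin n) → K → (EuclideanSpace ℝ (Fin n) →L[ℝ] ℝ)
  contF : ContinuousOn (fun p : EuclideanSpace ℝ (Fin n) × K => F p.1 p.2) (U ×ˢ Set.univ)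
  hasDF : ∀ x ∈ U, ∀ y : K, HasFDerivAt (fun x' => F x' y) (DF x y) x
  contDF : ContinuousOn (fun p : EuclideanSpace ℝ (Fin n) × K => DF p.1 p.2) (U ×ˢ Set.univ)
  isMax : ∀ x ∈ U, IsGreatest (Set.range fun y : K => F x y) (f x)

/-- `f` is lower-C¹ at `x₀`. -/
def LowerC1At (n : ℕ) (f : EuclideanSpace ℝ (Fin n) → ℝ)
    (x₀ : EuclideanSpace ℝ (Fin n)) : Prop :=
  Nonempty (LowerC1Witness n f x₀)

/-- `f` is upper-C¹ at `x₀` if `-f` is lower-C¹ at `x₀`. -/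
def UpperC1At (n : ℕ) (f : EuclideanSpace ℝ (Fin n) → ℝ)
    (x₀ : EuclideanSpace ℝ (Fin n)) : Prop :=
  LowerC1At n (fun x => -(f x)) x₀

/-- The Clarke directional derivative
`f°(x; d) = limsup_{y → x, t ↓ 0} (f(y + t d) − f(y))/t`. -/
def clarkeDeriv (n : ℕ) (f : EuclideanSpace ℝ (Fin n) → ℝ)
    (x d : EuclideanSpace ℝ (Fin n)) : ℝ :=
  Filter.limsup (fun p : EuclideanSpace ℝ (Fin n) × ℝ => (f (p.1 + p.2 • d) - f p.1) / p.2)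
    ((nhds x) ×ˢ (nhdsWithin 0 (Set.Ioi (0 : ℝ))))

/-- The difference quotients defining the Clarke derivative of a locally Lipschitz function are
eventually bounded above. -/
theorem isBoundedUnder_clarke_quotient {n : ℕ} {f : EuclideanSpace ℝ (Fin n) → ℝ}
    (hlip : LocallyLipschitz f) (x d : EuclideanSpace ℝ (Fin n)) :
    Filter.IsBoundedUnder (· ≤ ·) (nhds x ×ˢ nhdsWithin 0 (Set.Ioi (0 : ℝ)))
      (fun p : EuclideanSpace ℝ (Fin n) × ℝ => (f (p.1 + p.2 • d) - f p.1) / p.2) := by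
  obtain ⟨L, s, hs, hL⟩ := hlip x
  refine ⟨L * ‖d‖, Filter.eventually_map.2 ?_⟩
  have hfst : Filter.Tendsto Prod.fst (nhds x ×ˢ nhdsWithin 0 (Set.Ioi (0 : ℝ))) (nhds x) :=
    Filter.tendsto_fst
  have hsnd : Filter.Tendsto Prod.snd (nhds x ×ˢ nhdsWithin 0 (Set.Ioi (0 : ℝ)))
      (nhdsWithin 0 (Set.Ioi (0 : ℝ))) := Filter.tendsto_snd
  have hadd : Filter.Tendsto (fun p : EuclideanSpace ℝ (Fin n) × ℝ => p.1 + p.2 • d)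
      (nhds x ×ˢ nhdsWithin 0 (Set.Ioi (0 : ℝ))) (nhds x) := by
    simpa using hfst.add ((hsnd.mono_right nhdsWithin_le_nhds).smul_const d)
  filter_upwards [hfst hs, hadd hs, hsnd self_mem_nhdsWithin] with p h₁ h₂ h₃
  have hpos : 0 < p.2 := h₃
  rw [div_le_iff₀ hpos]
  have hdist := hL.dist_le_mul _ h₂ _ h₁
  rw [Real.dist_eq, dist_eq_norm, add_sub_cancel_left, norm_smul, Real.norm_of_nonneg hpos.le]
    at hdist
  linarith [le_abs_self (f (p.1 + p.2 • d) - f p.1)]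

/-- If `g` is a differentiable majorant of `f` touching `f` at `x`, then the differential of `g`
at `x` is dominated by the Clarke derivative of `f`. -/
theorem HasFDerivAt.le_clarkeDeriv_of_majorant {n : ℕ} {f g : EuclideanSpace ℝ (Fin n) → ℝ}
    {x : EuclideanSpace ℝ (Fin n)} {g' : EuclideanSpace ℝ (Fin n) →L[ℝ] ℝ}
    (hg : HasFDerivAt g g' x) (hlip : LocallyLipschitz f) (hle : ∀ᶠ z in nhds x, f z ≤ g z)
    (heq : f x = g x) (d : EuclideanSpace ℝ (Fin n)) :
    g' d ≤ clarkeDeriv n f x d := by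
  refine le_of_forall_lt fun a ha => ?_
  obtain ⟨b, hab, hb⟩ := exists_between ha
  refine hab.trans_le (Filter.le_limsup_of_frequently_le ?_
    (isBoundedUnder_clarke_quotient hlip x d))
  have hpath : Filter.Tendsto (fun t : ℝ => x - t • d) (nhdsWithin 0 (Set.Ioi 0)) (nhds x) := by
    refine Filter.Tendsto.mono_left ?_ nhdsWithin_le_nhds
    exact Continuous.tendsto' (by fun_prop) _ _ (by simp)
  have hslope : Filter.Tendsto (fun t : ℝ => t⁻¹ • (g (x + t • (-d)) - g x))
      (nhdsWithin 0 (Set.Ioi 0)) (nhds (g' (-d))) :=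
    (hg.hasLineDerivAt (-d)).tendsto_slope_zero_right
  rw [map_neg] at hslope
  refine (hpath.prodMk Filter.tendsto_id).frequently (Filter.Eventually.frequently ?_)
  filter_upwards [hslope.eventually_lt_const (neg_lt_neg hb), hpath.eventually hle,
    self_mem_nhdsWithin] with t h₁ h₂ h₃
  have hpos : 0 < t := h₃
  rw [smul_neg, ← sub_eq_add_neg, smul_eq_mul, inv_mul_eq_div, div_lt_iff₀ hpos] at h₁
  simp only [id_eq, sub_add_cancel]
  rw [le_div_iff₀ hpos]
  linarith

/-- The first-order expansions of the functions in a lower-C¹ representation are strict at the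
base point, uniformly in the parameter. -/
theorem LowerC1Witness.exists_uniform_strict_expansion {n : ℕ}
    {f : EuclideanSpace ℝ (Fin n) → ℝ} {x₀ : EuclideanSpace ℝ (Fin n)}
    (w : LowerC1Witness n f x₀) {ε : ℝ} (hε : 0 < ε) :
    ∃ r > 0, Metric.ball x₀ r ⊆ w.U ∧ ∀ x ∈ Metric.ball x₀ r, ∀ z ∈ Metric.ball x₀ r, ∀ y : w.K,
      |w.F z y - w.F x y - w.DF x y (z - x)| ≤ ε * ‖z - x‖ := by
  obtain ⟨K, U, hU, hx₀, F, DF, -, hDF, hcont, -⟩ := w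
  have hnear : ∀ᶠ x in nhds x₀, ∀ y ∈ (Set.univ : Set K), ‖DF x y - DF x₀ y‖ < ε / 2 := by
    refine isCompact_univ.eventually_forall_of_forall_eventually fun y _ => ?_
    have hat : ContinuousAt (fun p : EuclideanSpace ℝ (Fin n) × K => DF p.1 p.2) (x₀, y) :=
      hcont.continuousAt (prod_mem_nhds (hU.mem_nhds hx₀) Filter.univ_mem)
    have hbase : ContinuousAt (fun p : EuclideanSpace ℝ (Fin n) × K => DF x₀ p.2) (x₀, y) :=
      ContinuousAt.comp (x := (x₀, y)) (g := fun p : EuclideanSpace ℝ (Fin n) × K => DF p.1 p.2)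
        (f := fun p : EuclideanSpace ℝ (Fin n) × K => (x₀, p.2)) hat (by fun_prop)
    exact (hat.sub hbase).norm.eventually_lt_const (by simpa using half_pos hε)
  obtain ⟨r, hr, hball⟩ := Metric.mem_nhds_iff.1 (hnear.and (hU.mem_nhds hx₀))
  refine ⟨r, hr, fun x hx => (hball hx).2, fun x hx z hz y => ?_⟩
  refine (convex_ball x₀ r).norm_image_sub_le_of_norm_hasFDerivWithin_le'
    (fun v hv => (hDF v (hball hv).2 y).hasFDerivWithinAt) (fun v hv => ?_) hx hz
  calc ‖DF v y - DF x y‖ = ‖(DF v y - DF x₀ y) - (DF x y - DF x₀ y)‖ := by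
        rw [sub_sub_sub_cancel_right]
    _ ≤ ‖DF v y - DF x₀ y‖ + ‖DF x y - DF x₀ y‖ := norm_sub_le _ _
    _ ≤ ε := by linarith [(hball hv).1 y trivial, (hball hx).1 y trivial]

/-- if `f` is locally Lipschitz and upper-C¹ at `x̄`, then its standard model
`φ♯(η, δ) = f δ + f°(δ; η − δ)` is strict at `x̄`. -/
theorem upperC1At_strict_standard_model (n : ℕ) (f : EuclideanSpace ℝ (Fin n) → ℝ)
    (xbar : EuclideanSpace ℝ (Fin n)) (hlip : LocallyLipschitz f)
    (hupper : UpperC1At n f xbar) :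
    ∀ ε > (0 : ℝ), ∃ r > (0 : ℝ), ∀ δ ∈ Metric.ball xbar r, ∀ η ∈ Metric.ball xbar r,
      f η ≤ f δ + clarkeDeriv n f δ (η - δ) + ε * ‖η - δ‖ := by
  intro ε hε
  obtain ⟨w⟩ := hupper
  obtain ⟨r, hr, hsub, hexp⟩ := w.exists_uniform_strict_expansion hε
  refine ⟨r, hr, fun δ hδ η hη => ?_⟩
  obtain ⟨y, hy⟩ := (w.isMax δ (hsub hδ)).1
  dsimp only at hy
  have hmajor : ∀ z ∈ w.U, f z ≤ -w.F z y := fun z hz =>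
    le_neg_of_le_neg ((w.isMax z hz).2 ⟨y, rfl⟩)
  have hclarke : (-w.DF δ y) (η - δ) ≤ clarkeDeriv n f δ (η - δ) :=
    (w.hasDF δ (hsub hδ) y).fun_neg.le_clarkeDeriv_of_majorant hlip
      (Filter.mem_of_superset (w.openU.mem_nhds (hsub hδ)) hmajor) (eq_neg_iff_add_eq_zero.2 (by linarith)) _
  have hlower := (abs_le.1 (hexp δ hδ η hη y)).1
  have hle := hmajor η (hsub hη)
  simp only [neg_apply] at hclarke
  linarith

end
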